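/- Let C be a K-coalgebra with coradical C₀ = ⊕_{i∈I} D^i, where the D^i are simple subcoalgebras of C. Then C₁ = Σ_{i,j∈I} (D^i ∧_C D^j), where C₁ = C₀ ∧_C C₀. -/

import Mathlib

open TensorProduct

noncomputable section
namespace DG

variable (K : Type*) [Field K] (C : Type*) [AddCommGroup C] [Module K C] [Coalgebra K C]

/-- The image of `D ⊗ E` inside `C ⊗ C`, for submodules `D E : Submodule K C`. -/
def tsub (D E : Submodule K C) : Submodule K (C ⊗[K] C) :=
  LinearMap.range (TensorProduct.map D.subtype E.subtype)

/-- The wedge `D ∧_C E = {c | Δ c ∈ D ⊗ C + C ⊗ E}` of two subspaces of a coalgebra. -/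
def wedge (D E : Submodule K C) : Submodule K C :=
  (tsub K C D ⊤ ⊔ tsub K C ⊤ E).comap (Coalgebra.comul : C →ₗ[K] C ⊗[K] C)

/-- A subspace `D` is a subcoalgebra if `Δ(D) ⊆ D ⊗ D`. -/
def IsSubcoalgebra (D : Submodule K C) : Prop :=
  ∀ x ∈ D, (Coalgebra.comul : C →ₗ[K] C ⊗[K] C) x ∈ tsub K C D D

/-- A simple subcoalgebra: a nonzero subcoalgebra with no nonzero proper subcoalgebras. -/
def IsSimpleSubcoalgebra (D : Submodule K C) : Prop :=
  IsSubcoalgebra K C D ∧ D ≠ ⊥ ∧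
    ∀ E : Submodule K C, IsSubcoalgebra K C E → E ≤ D → E = ⊥ ∨ E = D

/-- The coradical `C₀`: the sum of all simple subcoalgebras. -/
def coradical : Submodule K C := sSup {D | IsSimpleSubcoalgebra K C D}

/-- `C₁ = C₀ ∧_C C₀`, the second term of the coradical filtration. -/
def C1 : Submodule K C := wedge K C (coradical K C) (coradical K C)

section Contraction

variable {K C}

omit [Coalgebra K C] in
lemma tmul_mem_tsub {D E : Submodule K C} {d e : C} (hd : d ∈ D) (he : e ∈ E) :
    d ⊗ₜ[K] e ∈ tsub K C D E :=
  ⟨⟨d, hd⟩ ⊗ₜ ⟨e, he⟩, by simp⟩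

omit [Coalgebra K C] in
@[elab_as_elim]
lemma tsub_induction {D E : Submodule K C} {P : C ⊗[K] C → Prop} (zero : P 0)
    (tmul : ∀ d ∈ D, ∀ e ∈ E, P (d ⊗ₜ e)) (add : ∀ x y, P x → P y → P (x + y))
    {x : C ⊗[K] C} (hx : x ∈ tsub K C D E) : P x := by
  obtain ⟨t, rfl⟩ := hx
  induction t using TensorProduct.induction_on with
  | zero => simpa using zero
  | tmul d e => simpa using tmul d d.2 e e.2
  | add x y hx hy => simpa using add _ _ hx hy

omit [Coalgebra K C] in
lemma map_mem_tsub {D E D' E' : Submodule K C} {f g : C →ₗ[K] C} (hf : ∀ d ∈ D, f d ∈ D')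
    (hg : ∀ e ∈ E, g e ∈ E') {x : C ⊗[K] C} (hx : x ∈ tsub K C D E) :
    TensorProduct.map f g x ∈ tsub K C D' E' := by
  refine tsub_induction (by simp) (fun d hd e he => ?_) (fun x y hx hy => ?_) hx
  · simpa using tmul_mem_tsub (hf d hd) (hg e he)
  · simpa using add_mem hx hy

omit [Coalgebra K C] in
lemma tsub_mono {D E D' E' : Submodule K C} (hD : D ≤ D') (hE : E ≤ E') :
    tsub K C D E ≤ tsub K C D' E' := fun x hx => by
  simpa using map_mem_tsub (f := LinearMap.id) (g := LinearMap.id) hD hE hx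

lemma wedge_mono {D E D' E' : Submodule K C} (hD : D ≤ D') (hE : E ≤ E') :
    wedge K C D E ≤ wedge K C D' E' :=
  Submodule.comap_mono (sup_le_sup (tsub_mono hD le_rfl) (tsub_mono le_rfl hE))

lemma IsSubcoalgebra.le_wedge_self {D : Submodule K C} (hD : IsSubcoalgebra K C D) :
    D ≤ wedge K C D D := fun x hx =>
  Submodule.mem_sup_left (tsub_mono le_rfl le_top (hD x hx))

/-- The linear map `a ⊗ b ↦ f a • b`. -/
def contractLeft (f : C →ₗ[K] K) : C ⊗[K] C →ₗ[K] C :=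
  TensorProduct.lid K C ∘ₗ f.rTensor C

/-- The linear map `a ⊗ b ↦ f b • a`. -/
def contractRight (f : C →ₗ[K] K) : C ⊗[K] C →ₗ[K] C :=
  TensorProduct.rid K C ∘ₗ f.lTensor C

omit [Coalgebra K C] in
@[simp]
lemma contractLeft_tmul (f : C →ₗ[K] K) (a b : C) : contractLeft f (a ⊗ₜ b) = f a • b := by
  simp [contractLeft]

omit [Coalgebra K C] in
@[simp]
lemma contractRight_tmul (f : C →ₗ[K] K) (a b : C) : contractRight f (a ⊗ₜ b) = f b • a := by
  simp [contractRight]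

/-- The action `c ↦ ∑ f c₁ • c₂` of a functional on a coalgebra. -/
def hitLeft (f : C →ₗ[K] K) : C →ₗ[K] C := contractLeft f ∘ₗ Coalgebra.comul

/-- The action `c ↦ ∑ f c₂ • c₁` of a functional on a coalgebra. -/
def hitRight (f : C →ₗ[K] K) : C →ₗ[K] C := contractRight f ∘ₗ Coalgebra.comul

@[simp]
lemma hitLeft_counit (c : C) : hitLeft (Coalgebra.counit : C →ₗ[K] K) c = c := by
  simp [hitLeft, contractLeft]

@[simp]
lemma hitRight_counit (c : C) : hitRight (Coalgebra.counit : C →ₗ[K] K) c = c := by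
  simp [hitRight, contractRight]

lemma hitLeft_sum {ι : Type*} (s : Finset ι) (f : ι → C →ₗ[K] K) (c : C) :
    hitLeft (∑ i ∈ s, f i) c = ∑ i ∈ s, hitLeft (f i) c := by
  simp [hitLeft, contractLeft, ← LinearMap.coe_rTensorHom, map_sum]

lemma hitRight_sum {ι : Type*} (s : Finset ι) (f : ι → C →ₗ[K] K) (c : C) :
    hitRight (∑ i ∈ s, f i) c = ∑ i ∈ s, hitRight (f i) c := by
  simp [hitRight, contractRight, ← LinearMap.coe_lTensorHom, map_sum]

lemma comul_hitLeft (f : C →ₗ[K] K) (c : C) :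
    Coalgebra.comul (R := K) (hitLeft f c) = (hitLeft f).rTensor C (Coalgebra.comul c) := by
  have h₁ (x : C ⊗[K] C) : (Coalgebra.comul : C →ₗ[K] C ⊗[K] C) (contractLeft f x) =
      (contractLeft f).rTensor C ((TensorProduct.assoc K C C C).symm
        (Coalgebra.comul.lTensor C x)) := by
    induction x using TensorProduct.induction_on with
    | zero => simp
    | add x y hx hy => simp only [map_add, hx, hy]
    | tmul a b =>
      simp only [contractLeft_tmul, map_smul, LinearMap.lTensor_tmul]
      induction Coalgebra.comul (R := K) b using TensorProduct.induction_on with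
      | zero => simp
      | add x y hx hy => simp only [smul_add, tmul_add, map_add, hx, hy]
      | tmul b c => simp [smul_tmul']
  rw [hitLeft, LinearMap.comp_apply, h₁, Coalgebra.coassoc_symm_apply, LinearMap.rTensor_comp]
  rfl

lemma comul_hitRight (f : C →ₗ[K] K) (c : C) :
    Coalgebra.comul (R := K) (hitRight f c) = (hitRight f).lTensor C (Coalgebra.comul c) := by
  have h₁ (x : C ⊗[K] C) : (Coalgebra.comul : C →ₗ[K] C ⊗[K] C) (contractRight f x) =
      (contractRight f).lTensor C (TensorProduct.assoc K C C C
        (Coalgebra.comul.rTensor C x)) := by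
    induction x using TensorProduct.induction_on with
    | zero => simp
    | add x y hx hy => simp only [map_add, hx, hy]
    | tmul a b =>
      simp only [contractRight_tmul, map_smul, LinearMap.rTensor_tmul]
      induction Coalgebra.comul (R := K) a using TensorProduct.induction_on with
      | zero => simp
      | add x y hx hy => simp only [smul_add, add_tmul, map_add, hx, hy]
      | tmul b c => simp
  rw [hitRight, LinearMap.comp_apply, h₁, Coalgebra.coassoc_apply, LinearMap.lTensor_comp]
  rfl

lemma comul_hitRight_hitLeft (f g : C →ₗ[K] K) (c : C) :
    Coalgebra.comul (R := K) (hitRight g (hitLeft f c)) =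
      TensorProduct.map (hitLeft f) (hitRight g) (Coalgebra.comul c) := by
  rw [comul_hitRight, comul_hitLeft, ← LinearMap.comp_apply, LinearMap.lTensor_comp_rTensor]

omit [Coalgebra K C] in
lemma contractLeft_mem {D E : Submodule K C} (f : C →ₗ[K] K) {x : C ⊗[K] C}
    (hx : x ∈ tsub K C D E) : contractLeft f x ∈ E :=
  tsub_induction (by simp) (fun d _ e he => by simpa using E.smul_mem _ he)
    (fun x y hx hy => by simpa using add_mem hx hy) hx

omit [Coalgebra K C] in
lemma contractRight_mem {D E : Submodule K C} (f : C →ₗ[K] K) {x : C ⊗[K] C}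
    (hx : x ∈ tsub K C D E) : contractRight f x ∈ D :=
  tsub_induction (by simp) (fun d hd e _ => by simpa using D.smul_mem _ hd)
    (fun x y hx hy => by simpa using add_mem hx hy) hx

omit [Coalgebra K C] in
lemma contractLeft_congr {D E : Submodule K C} {f g : C →ₗ[K] K} (hfg : ∀ d ∈ D, f d = g d)
    {x : C ⊗[K] C} (hx : x ∈ tsub K C D E) : contractLeft f x = contractLeft g x :=
  tsub_induction (by simp) (fun d hd e _ => by simp [hfg d hd])
    (fun x y hx hy => by simp [hx, hy]) hx

omit [Coalgebra K C] in
lemma contractRight_congr {D E : Submodule K C} {f g : C →ₗ[K] K} (hfg : ∀ e ∈ E, f e = g e)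
    {x : C ⊗[K] C} (hx : x ∈ tsub K C D E) : contractRight f x = contractRight g x :=
  tsub_induction (by simp) (fun d _ e he => by simp [hfg e he])
    (fun x y hx hy => by simp [hx, hy]) hx

lemma IsSubcoalgebra.iSup {I : Type*} {D : I → Submodule K C}
    (hD : ∀ i, IsSubcoalgebra K C (D i)) : IsSubcoalgebra K C (⨆ i, D i) := by
  change (⨆ i, D i) ≤ (tsub K C (⨆ i, D i) (⨆ i, D i)).comap Coalgebra.comul
  exact iSup_le fun i x hx => tsub_mono (le_iSup D i) (le_iSup D i) (hD i x hx)

omit [Coalgebra K C] in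
/-- For independent subspaces `D i` there are functionals agreeing with the given functional on
`D i` and vanishing on the other summands. -/
lemma exists_functional {I : Type*} {D : I → Submodule K C} (hD : iSupIndep D) (f : C →ₗ[K] K)
    (i : I) : ∃ e : C →ₗ[K] K, (∀ d ∈ D i, e d = f d) ∧ ∀ k ≠ i, ∀ d ∈ D k, e d = 0 := by
  obtain ⟨U, hU⟩ := exists_isCompl (D i ⊔ ⨆ k ≠ i, D k)
  have h := (hD i).isCompl_sup_right_of_isCompl_sup_left hU
  refine ⟨f ∘ₗ (D i).projection _ h, fun d hd => ?_, fun k hk d hd => ?_⟩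
  · rw [LinearMap.comp_apply, Submodule.projection_apply_of_mem_left h hd]
  · rw [LinearMap.comp_apply, Submodule.projection_apply_of_mem_right h, map_zero]
    exact Submodule.mem_sup_left (Submodule.mem_iSup_of_mem k (Submodule.mem_iSup_of_mem hk hd))

section Family

variable {I : Type*} {D : I → Submodule K C} {e : I → C →ₗ[K] K}

lemma hitLeft_mem (hsub : ∀ i, IsSubcoalgebra K C (D i))
    (hzero : ∀ i, ∀ k ≠ i, ∀ d ∈ D k, e i d = 0) (i : I) {c : C} (hc : c ∈ ⨆ i, D i) :
    hitLeft (e i) c ∈ D i := by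
  suffices (⨆ i, D i) ≤ (D i).comap (hitLeft (e i)) from this hc
  refine iSup_le fun k d hd => ?_
  obtain rfl | hk := eq_or_ne k i
  · exact contractLeft_mem _ (hsub k d hd)
  · have h : hitLeft (e i) d = contractLeft 0 (Coalgebra.comul d) :=
      contractLeft_congr (hzero i k hk) (hsub k d hd)
    simp [h, contractLeft]

lemma hitRight_mem (hsub : ∀ i, IsSubcoalgebra K C (D i))
    (hzero : ∀ i, ∀ k ≠ i, ∀ d ∈ D k, e i d = 0) (i : I) {c : C} (hc : c ∈ ⨆ i, D i) :
    hitRight (e i) c ∈ D i := by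
  suffices (⨆ i, D i) ≤ (D i).comap (hitRight (e i)) from this hc
  refine iSup_le fun k d hd => ?_
  obtain rfl | hk := eq_or_ne k i
  · exact contractRight_mem _ (hsub k d hd)
  · have h : hitRight (e i) d = contractRight 0 (Coalgebra.comul d) :=
      contractRight_congr (hzero i k hk) (hsub k d hd)
    simp [h, contractRight]

lemma hitRight_hitLeft_mem_wedge (hsub : ∀ i, IsSubcoalgebra K C (D i))
    (hzero : ∀ i, ∀ k ≠ i, ∀ d ∈ D k, e i d = 0) (i j : I) {c : C}
    (hc : c ∈ wedge K C (⨆ i, D i) (⨆ i, D i)) :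
    hitRight (e j) (hitLeft (e i) c) ∈ wedge K C (D i) (D j) := by
  obtain ⟨x, hx, y, hy, hxy⟩ := Submodule.mem_sup.1 (Submodule.mem_comap.1 hc)
  rw [wedge, Submodule.mem_comap, comul_hitRight_hitLeft, ← hxy, map_add]
  exact Submodule.add_mem_sup
    (map_mem_tsub (fun d hd => hitLeft_mem hsub hzero i hd) (fun _ _ => Submodule.mem_top) hx)
    (map_mem_tsub (fun _ _ => Submodule.mem_top) (fun d hd => hitRight_mem hsub hzero j hd) hy)

omit [Coalgebra K C] in
lemma eventually_sum_eq (f : C →ₗ[K] K) (hone : ∀ i, ∀ d ∈ D i, e i d = f d)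
    (hzero : ∀ i, ∀ k ≠ i, ∀ d ∈ D k, e i d = 0) {d : C} (hd : d ∈ ⨆ i, D i) :
    ∀ᶠ s : Finset I in Filter.atTop, (∑ i ∈ s, e i) d = f d := by
  induction hd using Submodule.iSup_induction' with
  | zero => simp
  | add x y _ _ hx hy =>
    filter_upwards [hx, hy] with s hx hy
    rw [map_add, map_add, hx, hy]
  | mem k d hd =>
    filter_upwards [Filter.eventually_ge_atTop {k}] with s hs
    rw [LinearMap.sum_apply, Finset.sum_eq_single_of_mem k (by simpa using hs)
      fun i _ hi => hzero i k hi.symm d hd, hone k d hd]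

omit [Coalgebra K C] in
lemma eventually_contractLeft_eq (f : C →ₗ[K] K) (hone : ∀ i, ∀ d ∈ D i, e i d = f d)
    (hzero : ∀ i, ∀ k ≠ i, ∀ d ∈ D k, e i d = 0) {E : Submodule K C} {x : C ⊗[K] C}
    (hx : x ∈ tsub K C (⨆ i, D i) E) :
    ∀ᶠ s : Finset I in Filter.atTop, contractLeft (∑ i ∈ s, e i) x = contractLeft f x := by
  refine tsub_induction (by simp) (fun d hd c _ => ?_) (fun x y hx hy => ?_) hx
  · filter_upwards [eventually_sum_eq f hone hzero hd] with s hs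
    rw [contractLeft_tmul, contractLeft_tmul, hs]
  · filter_upwards [hx, hy] with s hx hy
    rw [map_add, map_add, hx, hy]

omit [Coalgebra K C] in
lemma eventually_contractRight_eq (f : C →ₗ[K] K) (hone : ∀ i, ∀ d ∈ D i, e i d = f d)
    (hzero : ∀ i, ∀ k ≠ i, ∀ d ∈ D k, e i d = 0) {E : Submodule K C} {x : C ⊗[K] C}
    (hx : x ∈ tsub K C E (⨆ i, D i)) :
    ∀ᶠ s : Finset I in Filter.atTop, contractRight (∑ i ∈ s, e i) x = contractRight f x := by
  refine tsub_induction (by simp) (fun c _ d hd => ?_) (fun x y hx hy => ?_) hx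
  · filter_upwards [eventually_sum_eq f hone hzero hd] with s hs
    rw [contractRight_tmul, contractRight_tmul, hs]
  · filter_upwards [hx, hy] with s hx hy
    rw [map_add, map_add, hx, hy]

lemma eventually_sub_hitLeft_mem (hone : ∀ i, ∀ d ∈ D i, e i d = Coalgebra.counit d)
    (hzero : ∀ i, ∀ k ≠ i, ∀ d ∈ D k, e i d = 0) {E : Submodule K C} {c : C}
    (hc : c ∈ wedge K C (⨆ i, D i) E) :
    ∀ᶠ s : Finset I in Filter.atTop, c - hitLeft (∑ i ∈ s, e i) c ∈ E := by
  obtain ⟨x, hx, y, hy, hxy⟩ := Submodule.mem_sup.1 (Submodule.mem_comap.1 hc)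
  filter_upwards [eventually_contractLeft_eq _ hone hzero hx] with s hs
  nth_rw 1 [← hitLeft_counit (K := K) c]
  rw [hitLeft, hitLeft, LinearMap.comp_apply, LinearMap.comp_apply, ← hxy, map_add, map_add, hs,
    add_sub_add_left_eq_sub]
  exact sub_mem (contractLeft_mem _ hy) (contractLeft_mem _ hy)

lemma eventually_sub_hitRight_mem (hone : ∀ i, ∀ d ∈ D i, e i d = Coalgebra.counit d)
    (hzero : ∀ i, ∀ k ≠ i, ∀ d ∈ D k, e i d = 0) {E : Submodule K C} {c : C}
    (hc : c ∈ wedge K C E (⨆ i, D i)) :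
    ∀ᶠ s : Finset I in Filter.atTop, c - hitRight (∑ i ∈ s, e i) c ∈ E := by
  obtain ⟨x, hx, y, hy, hxy⟩ := Submodule.mem_sup.1 (Submodule.mem_comap.1 hc)
  filter_upwards [eventually_contractRight_eq _ hone hzero hy] with s hs
  nth_rw 1 [← hitRight_counit (K := K) c]
  rw [hitRight, hitRight, LinearMap.comp_apply, LinearMap.comp_apply, ← hxy, map_add, map_add, hs,
    add_sub_add_right_eq_sub]
  exact sub_mem (contractRight_mem _ hx) (contractRight_mem _ hx)

end Family

/-- The wedge of a direct sum of subcoalgebras with itself is the sum of the pairwise wedges. -/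
theorem wedge_iSup_eq_iSup_wedge {I : Type*} {D : I → Submodule K C}
    (hsub : ∀ i, IsSubcoalgebra K C (D i)) (hindep : iSupIndep D) :
    wedge K C (⨆ i, D i) (⨆ i, D i) = ⨆ i, ⨆ j, wedge K C (D i) (D j) := by
  refine le_antisymm (fun c hc => ?_)
    (iSup₂_le fun i j => wedge_mono (le_iSup D i) (le_iSup D j))
  choose e hone hzero using exists_functional hindep (Coalgebra.counit : C →ₗ[K] K)
  obtain ⟨s, hl, hr⟩ := ((eventually_sub_hitLeft_mem hone hzero hc).and
    (eventually_sub_hitRight_mem hone hzero hc)).exists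
  set f := ∑ i ∈ s, e i with hf
  have hmem : hitRight f (hitLeft f c) ∈ ⨆ i, ⨆ j, wedge K C (D i) (D j) := by
    rw [hf, hitRight_sum]
    refine sum_mem fun j _ => ?_
    rw [hitLeft_sum, map_sum]
    exact sum_mem fun i _ => Submodule.mem_iSup_of_mem i
      (Submodule.mem_iSup_of_mem j (hitRight_hitLeft_mem_wedge hsub hzero i j hc))
  have hle : (⨆ i, D i) ≤ ⨆ i, ⨆ j, wedge K C (D i) (D j) :=
    iSup_le fun i => (hsub i).le_wedge_self.trans
      (le_iSup₂ (f := fun i j => wedge K C (D i) (D j)) i i)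
  have hz : hitRight f (c - hitLeft f c) ∈ ⨆ i, D i :=
    contractRight_mem f (IsSubcoalgebra.iSup hsub _ hl)
  have hdecomp : c = hitRight f (hitLeft f c) +
      ((c - hitRight f c) + hitRight f (c - hitLeft f c)) := by
    rw [map_sub]; abel
  rw [hdecomp]
  exact add_mem hmem (hle (add_mem hr hz))

end Contraction

/-- **Statement 7** (Theorem 4.1(i)): if the coradical `C₀` decomposes as the (internal) direct
sum `⊕_{i ∈ I} Dⁱ` of simple subcoalgebras, then `C₁ = Σ_{i,j ∈ I} (Dⁱ ∧_C Dʲ)`. -/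
theorem C1_eq_sum_wedge {K : Type*} [Field K] {C : Type*} [AddCommGroup C] [Module K C]
    [Coalgebra K C] {I : Type*} (D : I → Submodule K C)
    (hsimple : ∀ i, IsSimpleSubcoalgebra K C (D i))
    (hindep : iSupIndep D)
    (hsum : ⨆ i, D i = coradical K C) :
    C1 K C = ⨆ i, ⨆ j, wedge K C (D i) (D j) := by
  rw [C1, ← hsum]
  exact wedge_iSup_eq_iSup_wedge (fun i => (hsimple i).1) hindep

end DG
end
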